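/- arXiv:1307.0986 — 11 statements merged into one kernel-verified Lean document; each statement's English description precedes it below -/
import Mathlib

section
/- Let a, b, c > 0 and let Q be a real symmetric traceless 3×3 matrix. Define J(Q) = −aQ − bQ² + c|Q|²Q + (b/3)|Q|²I, where |Q|² = tr(Q²). Then J(Q) = 0 if and only if there exist a unit vector n ∈ ℝ³ and a real number s such that Q = s(n⊗n − (1/3)I) and either s = 0 or 2cs² − bs − 3a = 0 (i.e., s = (b ± √(b²+24ac))/(4c)). -/
open Matrix

/-- Frobenius inner product `A:B = tr(A·B)`. -/
noncomputable def frob (A B : Matrix (Fin 3) (Fin 3) ℝ) : ℝ := (A * B).trace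

/-- The bulk-energy gradient `J(Q) = −aQ − bQ² + c|Q|²Q + (b/3)|Q|²I`. -/
noncomputable def Jop (a b c : ℝ) (Q : Matrix (Fin 3) (Fin 3) ℝ) :
    Matrix (Fin 3) (Fin 3) ℝ :=
  (-a) • Q - b • (Q * Q) + (c * frob Q Q) • Q + (b / 3 * frob Q Q) • (1 : Matrix (Fin 3) (Fin 3) ℝ)

/-- A symmetric idempotent `3 × 3` matrix of trace one is `n ⊗ n` for a unit vector `n`. -/
theorem exists_eq_vecMulVec_of_isIdempotent {P : Matrix (Fin 3) (Fin 3) ℝ} (hs : P.IsSymm)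
    (hP : P * P = P) (ht : P.trace = 1) :
    ∃ n : Fin 3 → ℝ, n ⬝ᵥ n = 1 ∧ P = vecMulVec n n := by
  have hrow : ∀ i, P i ⬝ᵥ P i = P i i := fun i => by
    have h := congrFun (congrFun hP i) i
    rw [mul_apply] at h
    rw [← h, dotProduct]
    exact Finset.sum_congr rfl fun j _ => by rw [hs.apply i j]
  have hminor : ∀ i j k, P i i * P j k = P i j * P i k := by
    have hm : ∀ i j, P i 0 * P 0 j + P i 1 * P 1 j + P i 2 * P 2 j = P i j := fun i j => by
      simpa [mul_apply, Fin.sum_univ_three] using congrFun (congrFun hP i) j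
    have h00 := hm 0 0
    have h11 := hm 1 1
    have h22 := hm 2 2
    have h01 := hm 0 1
    have h02 := hm 0 2
    have h12 := hm 1 2
    rw [trace_fin_three] at ht
    have e1 := hs.apply 0 1
    have e2 := hs.apply 0 2
    have e3 := hs.apply 1 2
    simp only [e1, e2, e3] at h00 h11 h22 h01 h02 h12
    intro i j k
    fin_cases i <;> fin_cases j <;> fin_cases k <;> simp only [Fin.zero_eta, Fin.mk_one,
      Fin.reduceFinMk, e1, e2, e3] <;> grind
  obtain ⟨i, hi⟩ : ∃ i, P i i ≠ 0 := by
    by_contra! h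
    simp [trace_fin_three, h] at ht
  have hpos : 0 < P i i := lt_of_le_of_ne
    (hrow i ▸ Finset.sum_nonneg fun j _ => mul_self_nonneg (P i j)) hi.symm
  have hsq := Real.mul_self_sqrt hpos.le
  have hne := (Real.sqrt_pos.2 hpos).ne'
  refine ⟨(√(P i i))⁻¹ • P i, ?_, ?_⟩
  · rw [smul_dotProduct, dotProduct_smul, hrow, smul_eq_mul, smul_eq_mul]
    field_simp
    linarith
  · ext j k
    simp only [vecMulVec_apply, Pi.smul_apply, smul_eq_mul]
    field_simp
    have h := hminor i j k
    rw [pow_two, hsq]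
    linarith

/-- Cayley–Hamilton for a traceless `3 × 3` matrix. -/
theorem cube_eq_of_trace_eq_zero {Q : Matrix (Fin 3) (Fin 3) ℝ} (ht : Q.trace = 0) :
    Q * Q * Q = (frob Q Q / 2) • Q + Q.det • (1 : Matrix (Fin 3) (Fin 3) ℝ) := by
  rw [trace_fin_three] at ht
  have h2 : Q 2 2 = -Q 0 0 - Q 1 1 := by linarith
  ext i j
  fin_cases i <;> fin_cases j <;>
    simp [frob, trace_fin_three, mul_apply, Fin.sum_univ_three, det_fin_three, h2] <;> ring

theorem frob_self_eq_zero {Q : Matrix (Fin 3) (Fin 3) ℝ} (hs : Q.IsSymm) (h : frob Q Q = 0) :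
    Q = 0 := by
  rw [← trace_conjTranspose_mul_self_eq_zero_iff, conjTranspose_eq_transpose_of_trivial, hs.eq]
  exact h

theorem Jop_uniaxial (a b c s : ℝ) {n : Fin 3 → ℝ} (hn : n ⬝ᵥ n = 1) :
    Jop a b c (s • (vecMulVec n n - (1 / 3 : ℝ) • (1 : Matrix (Fin 3) (Fin 3) ℝ))) =
      (s * (2 * c * s ^ 2 - b * s - 3 * a) / 3) •
        (vecMulVec n n - (1 / 3 : ℝ) • (1 : Matrix (Fin 3) (Fin 3) ℝ)) := by
  have hM : vecMulVec n n * vecMulVec n n = vecMulVec n n := by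
    rw [vecMulVec_mul_vecMulVec, hn, one_smul]
  have htr : (vecMulVec n n).trace = 1 := by rw [trace_vecMulVec, hn]
  set M := vecMulVec n n
  have hsq : (s • (M - (1 / 3 : ℝ) • (1 : Matrix (Fin 3) (Fin 3) ℝ))) *
      (s • (M - (1 / 3 : ℝ) • (1 : Matrix (Fin 3) (Fin 3) ℝ))) =
      (s ^ 2 / 3) • M + (s ^ 2 / 9) • (1 : Matrix (Fin 3) (Fin 3) ℝ) := by
    simp only [smul_mul_assoc, mul_smul_comm, sub_mul, mul_sub, hM, one_mul, mul_one]
    module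
  have hf : frob (s • (M - (1 / 3 : ℝ) • (1 : Matrix (Fin 3) (Fin 3) ℝ)))
      (s • (M - (1 / 3 : ℝ) • (1 : Matrix (Fin 3) (Fin 3) ℝ))) = 2 * s ^ 2 / 3 := by
    rw [frob, hsq, trace_add, trace_smul, trace_smul, htr, trace_one]
    simp
    ring
  rw [Jop, hf, hsq]
  module

/-- Critical points of the bulk energy: `J(Q) = 0` iff `Q = s(n⊗n − (1/3)I)` for a unit
vector `n` and `s = 0` or `2cs² − bs − 3a = 0`. -/
theorem stmt_0 (a b c : ℝ) (ha : 0 < a) (hb : 0 < b) (hc : 0 < c)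
    (Q : Matrix (Fin 3) (Fin 3) ℝ) (hQsymm : Q.IsSymm) (hQtr : Q.trace = 0) :
    Jop a b c Q = 0 ↔
      ∃ (n : Fin 3 → ℝ) (s : ℝ), n ⬝ᵥ n = 1 ∧
        Q = s • (vecMulVec n n - (1 / 3 : ℝ) • (1 : Matrix (Fin 3) (Fin 3) ℝ)) ∧
        (s = 0 ∨ 2 * c * s ^ 2 - b * s - 3 * a = 0) := by
  constructor
  · intro hJ
    by_cases hQ : Q = 0
    · exact ⟨Pi.single 0 1, 0, by simp, by simp [hQ], Or.inl rfl⟩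
    have hCH := cube_eq_of_trace_eq_zero hQtr
    have ht0 : frob Q Q ≠ 0 := fun h => hQ (frob_self_eq_zero hQsymm h)
    rw [Jop] at hJ
    set t := frob Q Q
    obtain ⟨m, hm⟩ : ∃ m, b * m = c * t - a := ⟨(c * t - a) / b, by field_simp⟩
    have hQ2 : Q * Q = m • Q + (t / 3) • (1 : Matrix (Fin 3) (Fin 3) ℝ) := by
      apply smul_right_injective _ hb.ne'
      simp only [smul_add, smul_smul, hm]
      rw [← sub_eq_zero, ← neg_eq_zero, ← hJ]
      module
    have hlin : (m ^ 2 - t / 6) • Q = (Q.det - m * t / 3) • (1 : Matrix (Fin 3) (Fin 3) ℝ) := by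
      rw [hQ2, add_mul, smul_mul_assoc, smul_mul_assoc, one_mul, hQ2] at hCH
      rw [← sub_eq_zero] at hCH ⊢
      rw [← hCH]
      module
    have hdet : Q.det - m * t / 3 = 0 := by
      have h := congrArg trace hlin
      rw [trace_smul, trace_smul, hQtr, trace_one] at h
      simpa using h.symm
    rw [hdet, zero_smul, smul_eq_zero, or_iff_left hQ] at hlin
    have ht : t = 6 * m ^ 2 := by linarith
    have hm0 : m ≠ 0 := by
      rintro rfl
      exact ht0 (by simpa using ht)
    obtain ⟨n, hn, hPn⟩ := exists_eq_vecMulVec_of_isIdempotent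
      (P := (3 * m)⁻¹ • Q + (1 / 3 : ℝ) • (1 : Matrix (Fin 3) (Fin 3) ℝ))
      ((hQsymm.smul _).add (isSymm_one.smul _))
      (by
        simp only [add_mul, mul_add, smul_mul_assoc, mul_smul_comm, hQ2, ht, one_mul, mul_one]
        match_scalars <;> field_simp <;> ring)
      (by simp [hQtr])
    refine ⟨n, 3 * m, hn, ?_, Or.inr ?_⟩
    · rw [← hPn, add_sub_cancel_right, smul_smul, mul_inv_cancel₀ (by simpa using hm0), one_smul]
    · rw [ht] at hm
      linarith
  · rintro ⟨n, s, hn, rfl, hs⟩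
    rw [Jop_uniaxial a b c s hn]
    rcases hs with hs | hs <;> simp [hs]
end

section
/- Let a, b, c > 0 and s = (b + √(b²+24ac))/(4c). For every unit vector n ∈ ℝ³, the linearized operator H_{s,n} maps 𝕊₀ into Q_out(n) (i.e., H_{s,n}(Q) is orthogonal to every element of Q_in(n) for all Q ∈ 𝕊₀), and H_{s,n} vanishes on Q_in(n) (i.e., H_{s,n}(n⊗v + v⊗n) = 0 for every v ∈ ℝ³ with v·n = 0). -/
open Matrix

/-- `Q_in(n) = {n⊗v + v⊗n : v·n = 0}`. -/
def Qin (n : Fin 3 → ℝ) : Set (Matrix (Fin 3) (Fin 3) ℝ) :=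
  {R | ∃ v : Fin 3 → ℝ, v ⬝ᵥ n = 0 ∧ R = vecMulVec n v + vecMulVec v n}

/-- `Q_out(n)`: the orthogonal complement of `Q_in(n)` in the space of symmetric
traceless 3×3 matrices, w.r.t. the Frobenius inner product. -/
noncomputable def Qout (n : Fin 3 → ℝ) : Set (Matrix (Fin 3) (Fin 3) ℝ) :=
  {Q | Q.IsSymm ∧ Q.trace = 0 ∧ ∀ R ∈ Qin n, frob Q R = 0}

/-- The linearized operator
`H_{s,n}(Q) = bs(Q − (nn·Q + Q·nn) + (2/3)(Q:nn)I) + 2cs²(Q:nn)(nn − (1/3)I)`. -/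
noncomputable def Hop (b c s : ℝ) (n : Fin 3 → ℝ) (Q : Matrix (Fin 3) (Fin 3) ℝ) :
    Matrix (Fin 3) (Fin 3) ℝ :=
  (b * s) • (Q - (vecMulVec n n * Q + Q * vecMulVec n n)
      + (2 / 3 * (n ⬝ᵥ Q *ᵥ n)) • (1 : Matrix (Fin 3) (Fin 3) ℝ))
    + (2 * c * s ^ 2 * (n ⬝ᵥ Q *ᵥ n)) •
      (vecMulVec n n - (1 / 3 : ℝ) • (1 : Matrix (Fin 3) (Fin 3) ℝ))

theorem Matrix.IsSymm.dotProduct_mulVec_comm {ι R : Type*} [Fintype ι] [CommSemiring R]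
    {A : Matrix ι ι R} (hA : A.IsSymm) (v w : ι → R) : v ⬝ᵥ A *ᵥ w = w ⬝ᵥ A *ᵥ v := by
  rw [dotProduct_mulVec, ← mulVec_transpose, hA.eq, dotProduct_comm]

theorem frob_vecMulVec (A : Matrix (Fin 3) (Fin 3) ℝ) (v w : Fin 3 → ℝ) :
    frob A (vecMulVec v w) = w ⬝ᵥ A *ᵥ v := by
  rw [frob, mul_vecMulVec, trace_vecMulVec, dotProduct_comm]

theorem frob_add_right (A B C : Matrix (Fin 3) (Fin 3) ℝ) :
    frob A (B + C) = frob A B + frob A C := by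
  simp only [frob, mul_add, trace_add]

theorem Hop_isSymm (b c s : ℝ) (n : Fin 3 → ℝ) {Q : Matrix (Fin 3) (Fin 3) ℝ}
    (hQ : Q.IsSymm) : (Hop b c s n Q).IsSymm := by
  simp only [Matrix.IsSymm, Hop, transpose_add, transpose_sub, transpose_smul, transpose_mul,
    transpose_vecMulVec, transpose_one, hQ.eq, add_comm (Q * vecMulVec n n)]

theorem Hop_trace (b c s : ℝ) {n : Fin 3 → ℝ} (hn : n ⬝ᵥ n = 1)
    {Q : Matrix (Fin 3) (Fin 3) ℝ} (hQ : Q.trace = 0) : (Hop b c s n Q).trace = 0 := by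
  have h : (Q * vecMulVec n n).trace = n ⬝ᵥ Q *ᵥ n := frob_vecMulVec Q n n
  simp only [Hop, trace_add, trace_sub, trace_smul, trace_mul_comm (vecMulVec n n) Q, h, hQ,
    trace_vecMulVec, hn, trace_one, Fintype.card_fin, smul_eq_mul]
  push_cast
  ring

/-- The director is an eigenvector of every matrix in the range of `H_{s,n}`. -/
theorem Hop_mulVec_self (b c s : ℝ) {n : Fin 3 → ℝ} (hn : n ⬝ᵥ n = 1)
    (Q : Matrix (Fin 3) (Fin 3) ℝ) :
    Hop b c s n Q *ᵥ n =
      ((n ⬝ᵥ Q *ᵥ n) * (-(b * s) / 3 + 4 * c * s ^ 2 / 3)) • n := by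
  have h : vecMulVec n n *ᵥ n = n := by simp [vecMulVec_mulVec, hn]
  simp only [Hop, add_mulVec, sub_mulVec, smul_mulVec, ← mulVec_mulVec, h, one_mulVec]
  rw [vecMulVec_mulVec, op_smul_eq_smul]
  module

/-- `H_{s,n}` maps symmetric traceless matrices into `Q_out(n)` and vanishes on `Q_in(n)`. -/
theorem stmt_1 (a b c : ℝ) (ha : 0 < a) (hb : 0 < b) (hc : 0 < c)
    (s : ℝ) (hs : s = (b + Real.sqrt (b ^ 2 + 24 * a * c)) / (4 * c))
    (n : Fin 3 → ℝ) (hn : n ⬝ᵥ n = 1) :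
    (∀ Q : Matrix (Fin 3) (Fin 3) ℝ, Q.IsSymm → Q.trace = 0 →
        Hop b c s n Q ∈ Qout n) ∧
    (∀ v : Fin 3 → ℝ, v ⬝ᵥ n = 0 →
        Hop b c s n (vecMulVec n v + vecMulVec v n) = 0) := by
  refine ⟨fun Q hQ hQ0 => ⟨Hop_isSymm b c s n hQ, Hop_trace b c s hn hQ0, ?_⟩, fun v hv => ?_⟩
  · rintro _ ⟨v, hv, rfl⟩
    rw [frob_add_right, frob_vecMulVec, frob_vecMulVec,
      (Hop_isSymm b c s n hQ).dotProduct_mulVec_comm n v, Hop_mulVec_self b c s hn,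
      dotProduct_smul, hv, smul_zero, add_zero]
  · have hv' : n ⬝ᵥ v = 0 := by rw [dotProduct_comm, hv]
    simp [Hop, mul_add, add_mul, vecMulVec_mul_vecMulVec, add_mulVec, vecMulVec_mulVec, hn, hv, hv']
end

section
/- Let a, b, c > 0 and s = (b + √(b²+24ac))/(4c). Set c₀ = min{bs, 2cs² − bs}. Then c₀ > 0, and for every unit vector n ∈ ℝ³ and every Q ∈ Q_out(n), one has H_{s,n}(Q) : Q ≥ c₀|Q|². -/
open Matrix

theorem trace_vecMulVec_mul (u v : Fin 3 → ℝ) (A : Matrix (Fin 3) (Fin 3) ℝ) :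
    (vecMulVec u v * A).trace = v ⬝ᵥ A *ᵥ u := by
  rw [vecMulVec_mul, trace_vecMulVec, dotProduct_mulVec, dotProduct_comm]

theorem frob_self_nonneg {A : Matrix (Fin 3) (Fin 3) ℝ} (hA : A.IsSymm) : 0 ≤ frob A A := by
  have h : frob A A = ∑ i, ∑ j, A i j * A i j := by
    simp only [frob, trace, diag_apply, mul_apply]
    exact Finset.sum_congr rfl fun i _ => Finset.sum_congr rfl fun j _ => by rw [hA.apply i j]
  rw [h]
  exact Finset.sum_nonneg fun i _ => Finset.sum_nonneg fun j _ => mul_self_nonneg _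

theorem dotProduct_mulVec_symm {Q : Matrix (Fin 3) (Fin 3) ℝ} (hQ : Q.IsSymm)
    (u v : Fin 3 → ℝ) : u ⬝ᵥ Q *ᵥ v = (Q *ᵥ u) ⬝ᵥ v := by
  rw [dotProduct_mulVec, ← mulVec_transpose, hQ.eq]

/-- A traceless symmetric `Q` satisfies `(3/2)(Q:nn)² ≤ |Q|²`. -/
theorem sq_le_frob_self {n : Fin 3 → ℝ} (hn : n ⬝ᵥ n = 1) {Q : Matrix (Fin 3) (Fin 3) ℝ}
    (hQ : Q.IsSymm) (htr : Q.trace = 0) :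
    3 / 2 * (n ⬝ᵥ Q *ᵥ n) ^ 2 ≤ frob Q Q := by
  set q := n ⬝ᵥ Q *ᵥ n with hq
  have hN : (vecMulVec n n).IsSymm := by
    ext i j
    simp [vecMulVec_apply, mul_comm]
  have h := frob_self_nonneg (A := Q - (3 / 2 * q) • vecMulVec n n +
    (q / 2) • (1 : Matrix (Fin 3) (Fin 3) ℝ))
    ((hQ.sub (hN.smul _)).add (isSymm_one.smul _))
  have h1 : (Q * vecMulVec n n).trace = q := by rw [trace_mul_comm, trace_vecMulVec_mul]
  have h2 : (vecMulVec n n * vecMulVec n n).trace = 1 := by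
    rw [trace_vecMulVec_mul, vecMulVec_mulVec, hn]
    simp [hn]
  simp only [frob, add_mul, sub_mul, mul_add, mul_sub, smul_mul_assoc, mul_smul_comm, one_mul,
    mul_one, trace_add, trace_sub, trace_smul, smul_eq_mul, h1, h2, htr, trace_vecMulVec_mul,
    ← hq, trace_vecMulVec, hn, trace_one, Fintype.card_fin] at h
  simp only [frob]
  push_cast at h
  linarith

/-- For `Q ∈ Q_out(n)` one has `|Qn|² = (Q:nn)²`. -/
theorem dotProduct_mulVec_self_of_mem_Qout {n : Fin 3 → ℝ} (hn : n ⬝ᵥ n = 1)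
    {Q : Matrix (Fin 3) (Fin 3) ℝ} (hQ : Q ∈ Qout n) :
    (Q *ᵥ n) ⬝ᵥ (Q *ᵥ n) = (n ⬝ᵥ Q *ᵥ n) ^ 2 := by
  obtain ⟨hs, -, ho⟩ := hQ
  set q := n ⬝ᵥ Q *ᵥ n with hq
  have hq' : (Q *ᵥ n) ⬝ᵥ n = q := dotProduct_comm _ _
  have h := ho _ ⟨Q *ᵥ n - q • n, by
    rw [sub_dotProduct, smul_dotProduct, hn, hq']; simp, rfl⟩
  rw [frob, trace_mul_comm, add_mul, trace_add, trace_vecMulVec_mul, trace_vecMulVec_mul,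
    dotProduct_mulVec_symm hs n, dotProduct_comm (Q *ᵥ n - q • n), dotProduct_sub,
    dotProduct_smul, hq', smul_eq_mul] at h
  linarith

theorem frob_Hop_self (b c s : ℝ) {n : Fin 3 → ℝ} (hn : n ⬝ᵥ n = 1)
    {Q : Matrix (Fin 3) (Fin 3) ℝ} (hQ : Q ∈ Qout n) :
    frob (Hop b c s n Q) Q =
      b * s * frob Q Q + 2 * (c * s ^ 2 - b * s) * (n ⬝ᵥ Q *ᵥ n) ^ 2 := by
  have hw := dotProduct_mulVec_self_of_mem_Qout hn hQ
  obtain ⟨hs, htr, -⟩ := hQ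
  have h1 : (vecMulVec n n * Q * Q).trace = (n ⬝ᵥ Q *ᵥ n) ^ 2 := by
    rw [Matrix.mul_assoc, trace_vecMulVec_mul, ← mulVec_mulVec, dotProduct_mulVec_symm hs, hw]
  have h2 : (Q * vecMulVec n n * Q).trace = (n ⬝ᵥ Q *ᵥ n) ^ 2 := by
    rw [Matrix.mul_assoc, trace_mul_comm, h1]
  simp only [frob, Hop, add_mul, sub_mul, smul_mul_assoc, one_mul, trace_add, trace_sub,
    trace_smul, smul_eq_mul, h1, h2, htr, trace_vecMulVec_mul]
  ring

/-- Coercivity of `H_{s,n}` on `Q_out(n)`: with `c₀ = min{bs, 2cs² − bs}` one has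
`c₀ > 0` and `H_{s,n}(Q) : Q ≥ c₀ |Q|²` for every `Q ∈ Q_out(n)`. -/
theorem stmt_2 (a b c : ℝ) (ha : 0 < a) (hb : 0 < b) (hc : 0 < c)
    (s : ℝ) (hs : s = (b + Real.sqrt (b ^ 2 + 24 * a * c)) / (4 * c))
    (c₀ : ℝ) (hc₀ : c₀ = min (b * s) (2 * c * s ^ 2 - b * s)) :
    0 < c₀ ∧
    ∀ (n : Fin 3 → ℝ), n ⬝ᵥ n = 1 →
      ∀ Q ∈ Qout n, frob (Hop b c s n Q) Q ≥ c₀ * frob Q Q := by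
  have hD : b < Real.sqrt (b ^ 2 + 24 * a * c) :=
    Real.lt_sqrt_of_sq_lt (by nlinarith [mul_pos ha hc])
  have hs4 : 4 * c * s = b + Real.sqrt (b ^ 2 + 24 * a * c) := by
    rw [hs]
    field_simp
  have hs0 : 0 < s := by
    rw [hs]
    positivity
  have hbs : 0 < b * s := mul_pos hb hs0
  have hcs : 0 < 2 * c * s ^ 2 - b * s := by
    have := mul_pos hs0 (show 0 < 2 * c * s - b by linarith)
    linarith
  refine ⟨hc₀ ▸ lt_min hbs hcs, fun n hn Q hQ => ?_⟩
  have hle := sq_le_frob_self hn hQ.1 hQ.2.1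
  have h1 : c₀ ≤ b * s := hc₀ ▸ min_le_left _ _
  have h2 : c₀ ≤ 2 * c * s ^ 2 - b * s := hc₀ ▸ min_le_right _ _
  rw [frob_Hop_self b c s hn hQ]
  have h3 := mul_nonneg (sub_nonneg.2 h1) (sub_nonneg.2 hle)
  have h4 : 0 ≤ (3 / 2 * (b * s - c₀) + 2 * (c * s ^ 2 - b * s)) * (n ⬝ᵥ Q *ᵥ n) ^ 2 :=
    mul_nonneg (by linarith) (sq_nonneg _)
  linarith
end

section
/- Let a, b, c > 0 and s = (b + √(b²+24ac))/(4c). For every unit vector n ∈ ℝ³, the operator H_{s,n} restricted to Q_out(n) is a bijection of Q_out(n) onto itself, and its inverse is given explicitly by G(Q) = (1/(bs))(Q − (nn·Q + Q·nn) + (2/3)(Q:nn)I) + ((4b+2cs)/(bs(4cs−b)))(Q:nn)(nn − (1/3)I); that is, G(H_{s,n}(Q)) = Q and H_{s,n}(G(Q)) = Q for every Q ∈ Q_out(n). -/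
open Matrix

/-- The explicit inverse
`G(Q) = (1/(bs))(Q − (nn·Q + Q·nn) + (2/3)(Q:nn)I)
        + ((4b+2cs)/(bs(4cs−b)))(Q:nn)(nn − (1/3)I)`. -/
noncomputable def Ginv (b c s : ℝ) (n : Fin 3 → ℝ) (Q : Matrix (Fin 3) (Fin 3) ℝ) :
    Matrix (Fin 3) (Fin 3) ℝ :=
  (1 / (b * s)) • (Q - (vecMulVec n n * Q + Q * vecMulVec n n)
      + (2 / 3 * (n ⬝ᵥ Q *ᵥ n)) • (1 : Matrix (Fin 3) (Fin 3) ℝ))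
    + ((4 * b + 2 * c * s) / (b * s * (4 * c * s - b)) * (n ⬝ᵥ Q *ᵥ n)) •
      (vecMulVec n n - (1 / 3 : ℝ) • (1 : Matrix (Fin 3) (Fin 3) ℝ))

theorem frob_vecMulVec_add {Q : Matrix (Fin 3) (Fin 3) ℝ} (hQ : Q.IsSymm) (n v : Fin 3 → ℝ) :
    frob Q (vecMulVec n v + vecMulVec v n) = 2 * (v ⬝ᵥ Q *ᵥ n) := by
  have h : Q *ᵥ v ⬝ᵥ n = v ⬝ᵥ Q *ᵥ n := by
    rw [dotProduct_mulVec, ← mulVec_transpose, hQ.eq]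
  rw [frob, mul_add, trace_add, mul_vecMulVec, mul_vecMulVec, trace_vecMulVec, trace_vecMulVec, h,
    dotProduct_comm (Q *ᵥ n) v]
  ring

/-- `Q_out(n)` consists of the symmetric traceless matrices having `n` as an eigenvector. -/
theorem mem_Qout_iff {n : Fin 3 → ℝ} (hn : n ⬝ᵥ n = 1) {Q : Matrix (Fin 3) (Fin 3) ℝ} :
    Q ∈ Qout n ↔ Q.IsSymm ∧ Q.trace = 0 ∧ Q *ᵥ n = (n ⬝ᵥ Q *ᵥ n) • n := by
  constructor
  · rintro ⟨hs, ht, ho⟩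
    refine ⟨hs, ht, ?_⟩
    set v := Q *ᵥ n - (n ⬝ᵥ Q *ᵥ n) • n with hv
    have hvn : v ⬝ᵥ n = 0 := by
      rw [hv, sub_dotProduct, smul_dotProduct, hn, dotProduct_comm]
      simp
    have h := ho _ ⟨v, hvn, rfl⟩
    rw [frob_vecMulVec_add hs] at h
    have hvv : v ⬝ᵥ v = 0 := by
      conv_lhs => rw [hv, ← hv, dotProduct_sub, dotProduct_smul, hvn]
      simp only [smul_zero, sub_zero]
      linarith
    exact sub_eq_zero.mp (dotProduct_self_eq_zero.mp hvv)
  · rintro ⟨hs, ht, he⟩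
    refine ⟨hs, ht, ?_⟩
    rintro R ⟨v, hv, rfl⟩
    rw [frob_vecMulVec_add hs, he, dotProduct_smul, hv]
    simp

/-- The operator `Q ↦ αQ + γ(Q:nn)(nn − (1/3)I)`. -/
noncomputable def axialOp (α γ : ℝ) (n : Fin 3 → ℝ) (Q : Matrix (Fin 3) (Fin 3) ℝ) :
    Matrix (Fin 3) (Fin 3) ℝ :=
  α • Q + (γ * (n ⬝ᵥ Q *ᵥ n)) • (vecMulVec n n - (1 / 3 : ℝ) • (1 : Matrix (Fin 3) (Fin 3) ℝ))

theorem axialOp_mulVec (α γ : ℝ) {n : Fin 3 → ℝ} (hn : n ⬝ᵥ n = 1)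
    {Q : Matrix (Fin 3) (Fin 3) ℝ} (hQ : Q ∈ Qout n) :
    axialOp α γ n Q *ᵥ n = ((α + 2 / 3 * γ) * (n ⬝ᵥ Q *ᵥ n)) • n := by
  obtain ⟨-, -, he⟩ := (mem_Qout_iff hn).mp hQ
  rw [axialOp, add_mulVec, smul_mulVec, smul_mulVec, sub_mulVec, smul_mulVec, one_mulVec,
    vecMulVec_mulVec, hn, he]
  ext i
  simp [hn]
  ring

theorem dotProduct_axialOp_mulVec (α γ : ℝ) {n : Fin 3 → ℝ} (hn : n ⬝ᵥ n = 1)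
    {Q : Matrix (Fin 3) (Fin 3) ℝ} (hQ : Q ∈ Qout n) :
    n ⬝ᵥ axialOp α γ n Q *ᵥ n = (α + 2 / 3 * γ) * (n ⬝ᵥ Q *ᵥ n) := by
  rw [axialOp_mulVec α γ hn hQ, dotProduct_smul, hn, smul_eq_mul, mul_one]

theorem axialOp_mem_Qout (α γ : ℝ) {n : Fin 3 → ℝ} (hn : n ⬝ᵥ n = 1)
    {Q : Matrix (Fin 3) (Fin 3) ℝ} (hQ : Q ∈ Qout n) : axialOp α γ n Q ∈ Qout n := by
  rw [mem_Qout_iff hn, dotProduct_axialOp_mulVec α γ hn hQ]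
  refine ⟨?_, ?_, axialOp_mulVec α γ hn hQ⟩
  · have h : (vecMulVec n n).IsSymm := transpose_vecMulVec n n
    exact (hQ.1.smul α).add ((h.sub (isSymm_one.smul _)).smul _)
  · rw [axialOp, trace_add, trace_smul, trace_smul, trace_sub, trace_smul, trace_vecMulVec, hn,
      trace_one, hQ.2.1]
    simp

theorem axialOp_axialOp (α γ α' γ' : ℝ) {n : Fin 3 → ℝ} (hn : n ⬝ᵥ n = 1)
    {Q : Matrix (Fin 3) (Fin 3) ℝ} (hQ : Q ∈ Qout n) :
    axialOp α' γ' n (axialOp α γ n Q) =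
      axialOp (α' * α) (α' * γ + γ' * (α + 2 / 3 * γ)) n Q := by
  rw [axialOp, dotProduct_axialOp_mulVec α γ hn hQ, axialOp, axialOp]
  module

theorem axialOp_one_zero (n : Fin 3 → ℝ) (Q : Matrix (Fin 3) (Fin 3) ℝ) :
    axialOp 1 0 n Q = Q := by
  simp [axialOp]

theorem sub_anticommutator_eq {n : Fin 3 → ℝ} (hn : n ⬝ᵥ n = 1)
    {Q : Matrix (Fin 3) (Fin 3) ℝ} (hQ : Q ∈ Qout n) :
    Q - (vecMulVec n n * Q + Q * vecMulVec n n)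
      + (2 / 3 * (n ⬝ᵥ Q *ᵥ n)) • (1 : Matrix (Fin 3) (Fin 3) ℝ) = axialOp 1 (-2) n Q := by
  obtain ⟨hs, -, he⟩ := (mem_Qout_iff hn).mp hQ
  have hr : Q * vecMulVec n n = (n ⬝ᵥ Q *ᵥ n) • vecMulVec n n := by
    conv_lhs => rw [mul_vecMulVec, he, smul_vecMulVec]
  have hl : vecMulVec n n * Q = (n ⬝ᵥ Q *ᵥ n) • vecMulVec n n := by
    conv_lhs => rw [vecMulVec_mul, ← mulVec_transpose, hs.eq, he, vecMulVec_smul]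
  rw [hl, hr, axialOp]
  module

theorem Hop_eq_axialOp (b c s : ℝ) {n : Fin 3 → ℝ} (hn : n ⬝ᵥ n = 1)
    {Q : Matrix (Fin 3) (Fin 3) ℝ} (hQ : Q ∈ Qout n) :
    Hop b c s n Q = axialOp (b * s) (2 * c * s ^ 2 - 2 * (b * s)) n Q := by
  rw [Hop, sub_anticommutator_eq hn hQ, axialOp, axialOp]
  module

theorem Ginv_eq_axialOp (b c s : ℝ) {n : Fin 3 → ℝ} (hn : n ⬝ᵥ n = 1)
    {Q : Matrix (Fin 3) (Fin 3) ℝ} (hQ : Q ∈ Qout n) :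
    Ginv b c s n Q = axialOp (1 / (b * s))
      ((4 * b + 2 * c * s) / (b * s * (4 * c * s - b)) - 2 * (1 / (b * s))) n Q := by
  rw [Ginv, sub_anticommutator_eq hn hQ, axialOp, axialOp]
  module

/-- `H_{s,n}` restricted to `Q_out(n)` is a bijection of `Q_out(n)` onto itself, whose
inverse is given explicitly by `G`. -/
theorem stmt_3 (a b c : ℝ) (ha : 0 < a) (hb : 0 < b) (hc : 0 < c)
    (s : ℝ) (hs : s = (b + Real.sqrt (b ^ 2 + 24 * a * c)) / (4 * c))
    (n : Fin 3 → ℝ) (hn : n ⬝ᵥ n = 1) :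
    Set.BijOn (Hop b c s n) (Qout n) (Qout n) ∧
    ∀ Q ∈ Qout n,
      Ginv b c s n (Hop b c s n Q) = Q ∧ Hop b c s n (Ginv b c s n Q) = Q := by
  have hsqrt : 0 < Real.sqrt (b ^ 2 + 24 * a * c) := Real.sqrt_pos.mpr (by positivity)
  have hs0 : s ≠ 0 := by
    rw [hs]
    positivity
  have hd : 4 * c * s - b ≠ 0 := by
    have h : 4 * c * s - b = Real.sqrt (b ^ 2 + 24 * a * c) := by
      rw [hs]
      field_simp
      ring
    exact h ▸ hsqrt.ne'
  have hb0 : b ≠ 0 := hb.ne'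
  have hH : ∀ Q ∈ Qout n, Hop b c s n Q ∈ Qout n := fun Q hQ => by
    rw [Hop_eq_axialOp b c s hn hQ]
    exact axialOp_mem_Qout _ _ hn hQ
  have hG : ∀ Q ∈ Qout n, Ginv b c s n Q ∈ Qout n := fun Q hQ => by
    rw [Ginv_eq_axialOp b c s hn hQ]
    exact axialOp_mem_Qout _ _ hn hQ
  have hGH : ∀ Q ∈ Qout n, Ginv b c s n (Hop b c s n Q) = Q := fun Q hQ => by
    rw [Ginv_eq_axialOp b c s hn (hH Q hQ), Hop_eq_axialOp b c s hn hQ,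
      axialOp_axialOp _ _ _ _ hn hQ]
    convert axialOp_one_zero n Q using 2
    · field_simp
    · generalize hd_eq : 4 * c * s - b = d at hd ⊢
      field_simp
      rw [← hd_eq]
      ring
  have hHG : ∀ Q ∈ Qout n, Hop b c s n (Ginv b c s n Q) = Q := fun Q hQ => by
    rw [Hop_eq_axialOp b c s hn (hG Q hQ), Ginv_eq_axialOp b c s hn hQ,
      axialOp_axialOp _ _ _ _ hn hQ]
    convert axialOp_one_zero n Q using 2
    · field_simp
    · generalize hd_eq : 4 * c * s - b = d at hd ⊢
      field_simp
      rw [← hd_eq]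
      ring
  exact ⟨Set.InvOn.bijOn ⟨hGH, hHG⟩ hH hG, fun Q hQ => ⟨hGH Q hQ, hHG Q hQ⟩⟩
end

section
/- Let L1, L2, L3 be real constants with L1 > 0 and L1 + L2 + L3 > 0, and set L0 = min(L1, L1+L2+L3). Then for every smooth compactly supported map Q : ℝ³ → 𝕊₀, ∫_{ℝ³} L(Q) : Q dx ≥ L0 ∫_{ℝ³} |∇Q|² dx, where |∇Q|² = Σ_{i,k,l} (∂_i Q_{kl})². -/
open Matrix MeasureTheory

/-- Partial derivative `∂_i f` of a scalar function on `ℝ³`. -/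
noncomputable def pd (i : Fin 3) (f : (Fin 3 → ℝ) → ℝ) (x : Fin 3 → ℝ) : ℝ :=
  fderiv ℝ f x (Pi.single i 1)

/-- The elastic operator, componentwise:
`(L(Q))_{kl} = −( L1 ΔQ_{kl} + (1/2)(L2+L3)( ∂_m∂_l Q_{km} + ∂_m∂_k Q_{lm}
  − (2/3)δ_{kl} ∂_i∂_j Q_{ij} ) )`. -/
noncomputable def Lop (L1 L2 L3 : ℝ) (Q : (Fin 3 → ℝ) → Matrix (Fin 3) (Fin 3) ℝ)
    (x : Fin 3 → ℝ) : Matrix (Fin 3) (Fin 3) ℝ :=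
  Matrix.of fun k l =>
    -(L1 * (∑ i, pd i (pd i (fun y => Q y k l)) x)
      + 1 / 2 * (L2 + L3) *
        ((∑ m, pd m (pd l (fun y => Q y k m)) x)
          + (∑ m, pd m (pd k (fun y => Q y l m)) x)
          - 2 / 3 * (if k = l then ∑ i, ∑ j, pd i (pd j (fun y => Q y i j)) x else 0)))

section PartialDerivative

variable {f g : (Fin 3 → ℝ) → ℝ}

theorem contDiff_pd (hf : ContDiff ℝ (⊤ : ℕ∞) f) (i : Fin 3) :
    ContDiff ℝ (⊤ : ℕ∞) (pd i f) :=
  (hf.fderiv_right (m := (⊤ : ℕ∞)) (by simp)).clm_apply contDiff_const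

theorem hasCompactSupport_pd (hf : HasCompactSupport f) (i : Fin 3) :
    HasCompactSupport (pd i f) :=
  hf.fderiv_apply ℝ _

theorem pd_comm (hf : ContDiff ℝ (⊤ : ℕ∞) f) (i j : Fin 3) : pd i (pd j f) = pd j (pd i f) := by
  have hd : Differentiable ℝ (fderiv ℝ f) :=
    (hf.fderiv_right (m := (⊤ : ℕ∞)) (by simp)).differentiable (by simp)
  have key (a b : Fin 3) (x : Fin 3 → ℝ) :
      pd a (pd b f) x = fderiv ℝ (fderiv ℝ f) x (Pi.single a 1) (Pi.single b 1) := by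
    change fderiv ℝ (fun y => fderiv ℝ f y (Pi.single b 1)) x (Pi.single a 1) = _
    rw [fderiv_clm_apply (hd x) (differentiableAt_const _)]
    simp
  funext x
  rw [key, key]
  exact (hf.contDiffAt.isSymmSndFDerivAt
    (minSmoothness_of_isRCLikeNormedField.trans_le (WithTop.coe_le_coe.2 le_top))).eq _ _

theorem integrable_mul_of_hasCompactSupport (hf : Continuous f) (hg : Continuous g)
    (hfs : HasCompactSupport f) : Integrable (fun x => f x * g x) :=
  (hf.mul hg).integrable_of_hasCompactSupport hfs.mul_right

theorem integral_pd_mul (hf : ContDiff ℝ (⊤ : ℕ∞) f) (hg : ContDiff ℝ (⊤ : ℕ∞) g)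
    (hfs : HasCompactSupport f) (i : Fin 3) :
    ∫ x, pd i f x * g x = -∫ x, f x * pd i g x := by
  have h := integral_mul_fderiv_eq_neg_fderiv_mul_of_integrable (μ := volume)
    (v := (Pi.single i 1 : Fin 3 → ℝ))
    (integrable_mul_of_hasCompactSupport (contDiff_pd hf i).continuous hg.continuous
      (hasCompactSupport_pd hfs i))
    (integrable_mul_of_hasCompactSupport hf.continuous (contDiff_pd hg i).continuous hfs)
    (integrable_mul_of_hasCompactSupport hf.continuous hg.continuous hfs)
    (fun x _ => hf.differentiable (by simp) x) (fun x _ => hg.differentiable (by simp) x)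
  change ∫ x, f x * pd i g x = -∫ x, pd i f x * g x at h
  rw [h, neg_neg]

theorem integral_pd_mul_pd_comm (hf : ContDiff ℝ (⊤ : ℕ∞) f) (hg : ContDiff ℝ (⊤ : ℕ∞) g)
    (hfs : HasCompactSupport f) (i j : Fin 3) :
    ∫ x, pd i f x * pd j g x = ∫ x, pd j f x * pd i g x := by
  rw [integral_pd_mul hf (contDiff_pd hg j) hfs, integral_pd_mul hf (contDiff_pd hg i) hfs,
    pd_comm hg]

end PartialDerivative

theorem sum_Lop_mul (L1 L2 L3 : ℝ) (Q : (Fin 3 → ℝ) → Matrix (Fin 3) (Fin 3) ℝ)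
    (hsymm : ∀ x, (Q x).IsSymm) (htr : ∀ x, (Q x).trace = 0) (x : Fin 3 → ℝ) :
    ∑ k, ∑ l, Lop L1 L2 L3 Q x k l * Q x k l =
      ∑ k, ∑ l, ∑ m, (-L1 * (pd m (pd m (fun y => Q y k l)) x * Q x k l)
        + -(L2 + L3) * (pd m (pd l (fun y => Q y k m)) x * Q x k l)) := by
  have ht : Q x 2 2 = -Q x 0 0 - Q x 1 1 := by
    have := htr x
    rw [Matrix.trace_fin_three] at this
    linarith
  have hs (k l : Fin 3) : Q x k l = Q x l k := (hsymm x).apply l k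
  simp only [Lop, Matrix.of_apply, Fin.sum_univ_three]
  simp
  rw [hs 1 0, hs 2 0, hs 2 1, ht]
  ring

section Rows

variable {q : Fin 3 → Fin 3 → (Fin 3 → ℝ) → ℝ}

theorem integrable_pd_mul_pd (hq : ∀ k l, ContDiff ℝ (⊤ : ℕ∞) (q k l))
    (hqs : ∀ k l, HasCompactSupport (q k l)) (i j k l k' l' : Fin 3) :
    Integrable (fun x => pd i (q k l) x * pd j (q k' l') x) :=
  integrable_mul_of_hasCompactSupport (contDiff_pd (hq k l) i).continuous
    (contDiff_pd (hq k' l') j).continuous (hasCompactSupport_pd (hqs k l) i)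

theorem sum_integral_pd_mul_pd_nonneg (hq : ∀ k l, ContDiff ℝ (⊤ : ℕ∞) (q k l))
    (hqs : ∀ k l, HasCompactSupport (q k l)) :
    0 ≤ ∑ k, ∑ l, ∑ m, ∫ x, pd l (q k m) x * pd m (q k l) x := by
  have hI := integrable_pd_mul_pd hq hqs
  refine Finset.sum_nonneg fun k _ => ?_
  have h : ∑ l, ∑ m, ∫ x, pd l (q k m) x * pd m (q k l) x
      = ∫ x, (∑ m, pd m (q k m) x) ^ 2 := by
    simp_rw [sq, Finset.sum_mul_sum]
    rw [integral_finsetSum _ fun _ _ => integrable_finsetSum _ fun _ _ => hI _ _ _ _ _ _,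
      Finset.sum_comm]
    refine Finset.sum_congr rfl fun m _ => ?_
    rw [integral_finsetSum _ fun _ _ => hI _ _ _ _ _ _]
    exact Finset.sum_congr rfl fun l _ => integral_pd_mul_pd_comm (hq k m) (hq k l) (hqs k m) l m
  rw [h]
  exact integral_nonneg fun x => sq_nonneg _

theorem sum_integral_pd_mul_pd_le (hq : ∀ k l, ContDiff ℝ (⊤ : ℕ∞) (q k l))
    (hqs : ∀ k l, HasCompactSupport (q k l)) :
    ∑ k, ∑ l, ∑ m, ∫ x, pd l (q k m) x * pd m (q k l) x ≤
      ∑ k, ∑ l, ∑ m, ∫ x, pd m (q k l) x * pd m (q k l) x := by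
  have hI := integrable_pd_mul_pd hq hqs
  refine Finset.sum_le_sum fun k _ => ?_
  have h (l m : Fin 3) : 2 * ∫ x, pd l (q k m) x * pd m (q k l) x ≤
      (∫ x, pd l (q k m) x * pd l (q k m) x) + ∫ x, pd m (q k l) x * pd m (q k l) x := by
    rw [← integral_const_mul, ← integral_add (hI _ _ _ _ _ _) (hI _ _ _ _ _ _)]
    refine integral_mono ((hI _ _ _ _ _ _).const_mul _)
      ((hI _ _ _ _ _ _).add (hI _ _ _ _ _ _)) fun x => ?_
    simp only
    nlinarith [sq_nonneg (pd l (q k m) x - pd m (q k l) x)]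
  have hsum := Finset.sum_le_sum fun l (_ : l ∈ Finset.univ) =>
    Finset.sum_le_sum fun m (_ : m ∈ Finset.univ) => h l m
  simp_rw [Finset.sum_add_distrib, ← Finset.mul_sum] at hsum
  rw [Finset.sum_comm (f := fun l m => ∫ x, pd l (q k m) x * pd l (q k m) x)] at hsum
  linarith

end Rows


/-- Coercivity of the elastic energy: if `L1 > 0` and `L1 + L2 + L3 > 0` then with
`L0 = min(L1, L1+L2+L3)`, for every smooth compactly supported `Q : ℝ³ → 𝕊₀`,
`∫ L(Q) : Q dx ≥ L0 ∫ |∇Q|² dx`. -/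
theorem stmt_4 (L1 L2 L3 : ℝ) (h1 : 0 < L1) (h123 : 0 < L1 + L2 + L3)
    (L0 : ℝ) (hL0 : L0 = min L1 (L1 + L2 + L3))
    (Q : (Fin 3 → ℝ) → Matrix (Fin 3) (Fin 3) ℝ)
    (hsmooth : ∀ k l, ContDiff ℝ (⊤ : ℕ∞) (fun y => Q y k l))
    (hsupp : ∀ k l, HasCompactSupport (fun y => Q y k l))
    (hsymm : ∀ x, (Q x).IsSymm) (htr : ∀ x, (Q x).trace = 0) :
    (∫ x : Fin 3 → ℝ, ∑ k, ∑ l, Lop L1 L2 L3 Q x k l * Q x k l) ≥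
      L0 * ∫ x : Fin 3 → ℝ, ∑ i, ∑ k, ∑ l, (pd i (fun y => Q y k l) x) ^ 2 := by
  have hI := integrable_pd_mul_pd hsmooth hsupp
  have hJ (i j k l k' l' : Fin 3) :
      Integrable (fun x => pd i (pd j (fun y => Q y k l)) x * Q x k' l') :=
    integrable_mul_of_hasCompactSupport (contDiff_pd (contDiff_pd (hsmooth k l) j) i).continuous
      (hsmooth k' l').continuous (hasCompactSupport_pd (hasCompactSupport_pd (hsupp k l) j) i)
  have hparts (i j k l k' l' : Fin 3) :
      ∫ x, pd i (pd j (fun y => Q y k l)) x * Q x k' l' =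
        -∫ x, pd j (fun y => Q y k l) x * pd i (fun y => Q y k' l') x :=
    integral_pd_mul (contDiff_pd (hsmooth k l) j) (hsmooth k' l')
      (hasCompactSupport_pd (hsupp k l) j) i
  have henergy : ∫ x, ∑ k, ∑ l, Lop L1 L2 L3 Q x k l * Q x k l =
      L1 * (∑ k, ∑ l, ∑ m, ∫ x, pd m (fun y => Q y k l) x * pd m (fun y => Q y k l) x)
        + (L2 + L3) *
          ∑ k, ∑ l, ∑ m, ∫ x, pd l (fun y => Q y k m) x * pd m (fun y => Q y k l) x := by
    have hK (k l m : Fin 3) : Integrable (fun x =>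
        -L1 * (pd m (pd m (fun y => Q y k l)) x * Q x k l)
          + -(L2 + L3) * (pd m (pd l (fun y => Q y k m)) x * Q x k l)) :=
      ((hJ m m k l k l).const_mul (-L1)).add
        ((hJ m l k m k l).const_mul (-(L2 + L3)))
    simp_rw [sum_Lop_mul L1 L2 L3 Q hsymm htr, Finset.mul_sum, ← Finset.sum_add_distrib]
    rw [integral_finsetSum _ fun _ _ => integrable_finsetSum _ fun _ _ =>
      integrable_finsetSum _ fun _ _ => hK _ _ _]
    refine Finset.sum_congr rfl fun k _ => ?_
    rw [integral_finsetSum _ fun _ _ => integrable_finsetSum _ fun _ _ => hK _ _ _]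
    refine Finset.sum_congr rfl fun l _ => ?_
    rw [integral_finsetSum _ fun _ _ => hK _ _ _]
    refine Finset.sum_congr rfl fun m _ => ?_
    rw [integral_add ((hJ _ _ _ _ _ _).const_mul _) ((hJ _ _ _ _ _ _).const_mul _),
      integral_const_mul, integral_const_mul, hparts, hparts]
    ring
  have hgrad : ∫ x : Fin 3 → ℝ, ∑ i, ∑ k, ∑ l, (pd i (fun y => Q y k l) x) ^ 2 =
      ∑ k, ∑ l, ∑ m, ∫ x, pd m (fun y => Q y k l) x * pd m (fun y => Q y k l) x := by
    simp_rw [sq]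
    rw [integral_finsetSum _ fun _ _ => integrable_finsetSum _ fun _ _ =>
      integrable_finsetSum _ fun _ _ => hI _ _ _ _ _ _]
    simp_rw [integral_finsetSum _ fun _ _ => integrable_finsetSum _ fun _ _ => hI _ _ _ _ _ _,
      integral_finsetSum _ fun _ _ => hI _ _ _ _ _ _]
    rw [Finset.sum_comm]
    exact Finset.sum_congr rfl fun k _ => Finset.sum_comm
  have hnonneg := sum_integral_pd_mul_pd_nonneg hsmooth hsupp
  have hle := sum_integral_pd_mul_pd_le hsmooth hsupp
  rw [henergy, hgrad, hL0]
  rcases le_total 0 (L2 + L3) with h | h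
  · rw [min_eq_left (by linarith)]
    nlinarith
  · rw [min_eq_right (by linarith)]
    nlinarith
end

section
/- Let n ∈ ℝ³ be a unit vector. For Q ∈ 𝕊₀ define P(Q) = (nn·Q + Q·nn) − 2(Q:nn)nn. Then P(Q) is the orthogonal projection of Q onto Q_in(n): namely, P(Q) ∈ Q_in(n) (indeed P(Q) = n⊗v + v⊗n with v = (I − nn)·Q·n), and Q − P(Q) is Frobenius-orthogonal to every element of Q_in(n). -/
open Matrix

/-- The projection `P(Q) = (nn·Q + Q·nn) − 2(Q:nn)nn`. -/
noncomputable def Pin (n : Fin 3 → ℝ) (Q : Matrix (Fin 3) (Fin 3) ℝ) :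
    Matrix (Fin 3) (Fin 3) ℝ :=
  (vecMulVec n n * Q + Q * vecMulVec n n) - (2 * (n ⬝ᵥ Q *ᵥ n)) • vecMulVec n n

/-- `P(Q)` is the orthogonal projection of `Q` onto `Q_in(n)`: it equals `n⊗v + v⊗n`
with `v = (I − nn)·Q·n` (so `v·n = 0`, i.e. `P(Q) ∈ Q_in(n)`), and `Q − P(Q)` is
Frobenius-orthogonal to every element of `Q_in(n)`. -/
theorem stmt_7 (n : Fin 3 → ℝ) (hn : n ⬝ᵥ n = 1)
    (Q : Matrix (Fin 3) (Fin 3) ℝ) (hQsymm : Q.IsSymm) (hQtr : Q.trace = 0) :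
    (Pin n Q = vecMulVec n (((1 : Matrix (Fin 3) (Fin 3) ℝ) - vecMulVec n n) *ᵥ (Q *ᵥ n))
        + vecMulVec (((1 : Matrix (Fin 3) (Fin 3) ℝ) - vecMulVec n n) *ᵥ (Q *ᵥ n)) n) ∧
    ((((1 : Matrix (Fin 3) (Fin 3) ℝ) - vecMulVec n n) *ᵥ (Q *ᵥ n)) ⬝ᵥ n = 0) ∧
    Pin n Q ∈ Qin n ∧
    (∀ R ∈ Qin n, frob (Q - Pin n Q) R = 0) := by
  have hsymm : n ᵥ* Q = Q *ᵥ n := by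
    rw [← mulVec_transpose, hQsymm.eq]
  have hv : ((1 : Matrix (Fin 3) (Fin 3) ℝ) - vecMulVec n n) *ᵥ (Q *ᵥ n)
      = Q *ᵥ n - (n ⬝ᵥ Q *ᵥ n) • n := by
    rw [sub_mulVec, one_mulVec, vecMulVec_mulVec]
    ext i
    simp [mul_comm]
  have hform : Pin n Q
      = vecMulVec n (((1 : Matrix (Fin 3) (Fin 3) ℝ) - vecMulVec n n) *ᵥ (Q *ᵥ n))
        + vecMulVec (((1 : Matrix (Fin 3) (Fin 3) ℝ) - vecMulVec n n) *ᵥ (Q *ᵥ n)) n := by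
    rw [hv, Pin, vecMulVec_mul, mul_vecMulVec, hsymm]
    ext i j
    simp only [Matrix.add_apply, Matrix.sub_apply, Matrix.smul_apply, vecMulVec_apply,
      Pi.sub_apply, Pi.smul_apply, smul_eq_mul]
    ring
  have horth : (((1 : Matrix (Fin 3) (Fin 3) ℝ) - vecMulVec n n) *ᵥ (Q *ᵥ n)) ⬝ᵥ n = 0 := by
    rw [hv, sub_dotProduct, smul_dotProduct, hn, dotProduct_comm (Q *ᵥ n) n]
    simp
  refine ⟨hform, horth, ⟨_, horth, hform⟩, ?_⟩
  rintro R ⟨u, hu, rfl⟩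
  have hu' : n ⬝ᵥ u = 0 := by rw [dotProduct_comm, hu]
  have hnQu : n ⬝ᵥ Q *ᵥ u = u ⬝ᵥ Q *ᵥ n := by
    rw [dotProduct_mulVec, hsymm, dotProduct_comm]
  rw [frob, mul_add, mul_vecMulVec, mul_vecMulVec, trace_add, trace_vecMulVec, trace_vecMulVec,
    hform, hv]
  simp only [sub_mulVec, add_mulVec, vecMulVec_mulVec, sub_dotProduct, add_dotProduct,
    smul_dotProduct, op_smul_eq_smul, hn, hu',
    dotProduct_comm (Q *ᵥ u) n, dotProduct_comm (Q *ᵥ n) n, dotProduct_comm (Q *ᵥ n) u, hnQu,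
    smul_eq_mul]
  ring
end

section
/- Let n ∈ ℝ³ be a unit vector and Q ∈ 𝕊₀. Then the matrices A = Q − (nn·Q + Q·nn) + (2/3)(Q:nn)I and B = (Q:nn)(nn − (1/3)I) both belong to 𝕊₀ and are Frobenius-orthogonal to Q_in(n); that is, A, B ∈ Q_out(n). -/
open Matrix

theorem frob_vecMulVec_add_vecMulVec {M : Matrix (Fin 3) (Fin 3) ℝ} (hM : M.IsSymm)
    (n v : Fin 3 → ℝ) : frob M (vecMulVec n v + vecMulVec v n) = 2 * (n ⬝ᵥ M *ᵥ v) := by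
  have h : v ⬝ᵥ M *ᵥ n = n ⬝ᵥ M *ᵥ v := by
    rw [dotProduct_mulVec, ← mulVec_transpose, hM.eq, dotProduct_comm]
  rw [frob, mul_add, mul_vecMulVec, mul_vecMulVec, trace_add, trace_vecMulVec, trace_vecMulVec,
    dotProduct_comm, h, dotProduct_comm, two_mul]

/-- A symmetric traceless `M` lies in `Q_out(n)` as soon as `n · M v = 0` for all `v ⟂ n`. -/
theorem mem_Qout_of_dotProduct_mulVec_eq_zero {n : Fin 3 → ℝ} {M : Matrix (Fin 3) (Fin 3) ℝ}
    (hM : M.IsSymm) (htr : M.trace = 0)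
    (h : ∀ v : Fin 3 → ℝ, n ⬝ᵥ v = 0 → n ⬝ᵥ M *ᵥ v = 0) : M ∈ Qout n := by
  refine ⟨hM, htr, ?_⟩
  rintro R ⟨v, hv, rfl⟩
  rw [frob_vecMulVec_add_vecMulVec hM, h v (by rwa [dotProduct_comm]), mul_zero]

/-- The matrices `A = Q − (nn·Q + Q·nn) + (2/3)(Q:nn)I` and
`B = (Q:nn)(nn − (1/3)I)` both belong to `Q_out(n)`. -/
theorem stmt_9 (n : Fin 3 → ℝ) (hn : n ⬝ᵥ n = 1)
    (Q : Matrix (Fin 3) (Fin 3) ℝ) (hQsymm : Q.IsSymm) (hQtr : Q.trace = 0) :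
    (Q - (vecMulVec n n * Q + Q * vecMulVec n n)
        + (2 / 3 * (n ⬝ᵥ Q *ᵥ n)) • (1 : Matrix (Fin 3) (Fin 3) ℝ)) ∈ Qout n ∧
    ((n ⬝ᵥ Q *ᵥ n) •
        (vecMulVec n n - (1 / 3 : ℝ) • (1 : Matrix (Fin 3) (Fin 3) ℝ))) ∈ Qout n := by
  have hnn : (vecMulVec n n).IsSymm := transpose_vecMulVec n n
  constructor <;> apply mem_Qout_of_dotProduct_mulVec_eq_zero
  · refine (hQsymm.sub ?_).add (isSymm_one.smul _)
    rw [IsSymm, transpose_add, transpose_mul, transpose_mul, hnn.eq, hQsymm.eq, add_comm]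
  · have h : (Q * vecMulVec n n).trace = n ⬝ᵥ Q *ᵥ n := by
      rw [mul_vecMulVec, trace_vecMulVec, dotProduct_comm]
    rw [trace_add, trace_sub, trace_add, trace_mul_comm (vecMulVec n n), h, hQtr, trace_smul,
      trace_one, Fintype.card_fin, smul_eq_mul]
    push_cast
    ring
  · intro v hv
    simp [add_mulVec, sub_mulVec, ← mulVec_mulVec, vecMulVec_mulVec, smul_mulVec,
      dotProduct_add, dotProduct_sub, dotProduct_smul, hn, hv]
  · exact (hnn.sub (isSymm_one.smul _)).smul _
  · rw [trace_smul, trace_sub, trace_vecMulVec, hn, trace_smul, trace_one, Fintype.card_fin]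
    norm_num
  · intro v hv
    simp [sub_mulVec, vecMulVec_mulVec, smul_mulVec, dotProduct_smul, hv]
end

section
/- Let a, b, c > 0, let n ∈ ℝ³ be a unit vector, and let s ∈ ℝ satisfy 2cs² − bs − 3a = 0. Set Q₀ = s(nn − (1/3)I). Then for every Q ∈ 𝕊₀, the linearization of J at Q₀ satisfies −aQ − b(Q₀·Q + Q·Q₀ − (2/3)(Q₀:Q)I) + c(|Q₀|²Q + 2(Q₀:Q)Q₀) = bs(Q − (nn·Q + Q·nn) + (2/3)(Q:nn)I) + 2cs²(Q:nn)(nn − (1/3)I) = H_{s,n}(Q). -/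
open Matrix

/-- A uniaxial tensor paired with a traceless matrix only sees its quadratic form at `n`. -/
lemma frob_uniaxial_traceless (s : ℝ) (n : Fin 3 → ℝ) (Q : Matrix (Fin 3) (Fin 3) ℝ)
    (hQ : Q.trace = 0) :
    frob (s • (vecMulVec n n - (1 / 3 : ℝ) • (1 : Matrix (Fin 3) (Fin 3) ℝ))) Q
      = s * (n ⬝ᵥ Q *ᵥ n) := by
  simp [frob, sub_mul, hQ, vecMulVec_mul, trace_vecMulVec, dotProduct_mulVec, dotProduct_comm]

/-- The squared Frobenius norm of a uniaxial tensor. -/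
lemma frob_uniaxial_self (s : ℝ) (n : Fin 3 → ℝ) (hn : n ⬝ᵥ n = 1) :
    frob (s • (vecMulVec n n - (1 / 3 : ℝ) • (1 : Matrix (Fin 3) (Fin 3) ℝ)))
        (s • (vecMulVec n n - (1 / 3 : ℝ) • (1 : Matrix (Fin 3) (Fin 3) ℝ)))
      = 2 / 3 * s ^ 2 := by
  simp [frob, sub_mul, mul_sub, vecMulVec_mul_vecMulVec, trace_vecMulVec, hn]
  ring

/-- The linearization of `J` at `Q₀ = s(nn − (1/3)I)` (with `2cs² − bs − 3a = 0`) equals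
`H_{s,n}`:
`−aQ − b(Q₀·Q + Q·Q₀ − (2/3)(Q₀:Q)I) + c(|Q₀|²Q + 2(Q₀:Q)Q₀) = H_{s,n}(Q)`. -/
theorem stmt_12 (a b c : ℝ) (ha : 0 < a) (hb : 0 < b) (hc : 0 < c)
    (n : Fin 3 → ℝ) (hn : n ⬝ᵥ n = 1)
    (s : ℝ) (hscrit : 2 * c * s ^ 2 - b * s - 3 * a = 0)
    (Q₀ : Matrix (Fin 3) (Fin 3) ℝ)
    (hQ₀ : Q₀ = s • (vecMulVec n n - (1 / 3 : ℝ) • (1 : Matrix (Fin 3) (Fin 3) ℝ)))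
    (Q : Matrix (Fin 3) (Fin 3) ℝ) (hQsymm : Q.IsSymm) (hQtr : Q.trace = 0) :
    (-a) • Q - b • (Q₀ * Q + Q * Q₀ - (2 / 3 * frob Q₀ Q) • (1 : Matrix (Fin 3) (Fin 3) ℝ))
        + c • ((frob Q₀ Q₀) • Q + (2 * frob Q₀ Q) • Q₀)
      = Hop b c s n Q := by
  rw [hQ₀, frob_uniaxial_traceless s n Q hQtr, frob_uniaxial_self s n hn, Hop]
  simp only [sub_mul, mul_sub, smul_mul_assoc, mul_smul_comm, one_mul, mul_one]
  have ha' : a = (2 * c * s ^ 2 - b * s) / 3 := by linarith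
  rw [ha']
  module
end

section
/- Let ξ, s ∈ ℝ, let n ∈ ℝ³ be a unit vector, let N ∈ ℝ³ satisfy N·n = 0, and set Q₀ = s(nn − (1/3)I). Then S_{Q₀}(N⊗n + n⊗N) = (ξ(2+s)/3)(N⊗n + n⊗N). -/
open Matrix

/-- `S_Q(M) = ξ( M·(Q + (1/3)I) + (Q + (1/3)I)·M − 2(Q + (1/3)I)(Q:M) )`. -/
noncomputable def Sop (ξ : ℝ) (Q M : Matrix (Fin 3) (Fin 3) ℝ) :
    Matrix (Fin 3) (Fin 3) ℝ :=
  ξ • (M * (Q + (1 / 3 : ℝ) • (1 : Matrix (Fin 3) (Fin 3) ℝ))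
      + (Q + (1 / 3 : ℝ) • (1 : Matrix (Fin 3) (Fin 3) ℝ)) * M
      - (2 * frob Q M) • (Q + (1 / 3 : ℝ) • (1 : Matrix (Fin 3) (Fin 3) ℝ)))

/-- With `Q₀ = s(nn − (1/3)I)` and `N ⊥ n`:
`S_{Q₀}(N⊗n + n⊗N) = (ξ(2+s)/3)(N⊗n + n⊗N)`. -/
theorem stmt_15 (ξ s : ℝ) (n : Fin 3 → ℝ) (hn : n ⬝ᵥ n = 1)
    (N : Fin 3 → ℝ) (hN : N ⬝ᵥ n = 0)
    (Q₀ : Matrix (Fin 3) (Fin 3) ℝ)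
    (hQ₀ : Q₀ = s • (vecMulVec n n - (1 / 3 : ℝ) • (1 : Matrix (Fin 3) (Fin 3) ℝ))) :
    Sop ξ Q₀ (vecMulVec N n + vecMulVec n N) =
      (ξ * (2 + s) / 3) • (vecMulVec N n + vecMulVec n N) := by
  have hN' : n ⬝ᵥ N = 0 := by rwa [dotProduct_comm]
  set M := vecMulVec N n + vecMulVec n N with hM
  have hMn : M * vecMulVec n n = vecMulVec N n := by
    simp [hM, add_mul, vecMulVec_mul_vecMulVec, hn, hN]
  have hnM : vecMulVec n n * M = vecMulVec n N := by
    simp [hM, mul_add, vecMulVec_mul_vecMulVec, hn, hN']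
  have htr : M.trace = 0 := by
    simp [hM, trace_vecMulVec, hN, hN']
  have hfrob : frob Q₀ M = 0 := by
    simp [frob, hQ₀, sub_mul, hnM, htr, trace_vecMulVec, hN']
  rw [Sop, hfrob, hQ₀]
  simp only [mul_add, add_mul, mul_sub, sub_mul, Matrix.mul_smul, Matrix.smul_mul, mul_one,
    one_mul, hMn, hnM, mul_zero, zero_smul, sub_zero]
  rw [hM]
  module
end

section
/- Let Γ, ξ, s ∈ ℝ, let n ∈ ℝ³ be a unit vector, let N ∈ ℝ³ satisfy N·n = 0, and let D ∈ 𝕊₀. Set Q₀ = s(nn − (1/3)I) and H₀ = −Γs(N⊗n + n⊗N) + Γ S_{Q₀}(D). Then H₀·Q₀ − Q₀·H₀ = Γs²(n⊗N − N⊗n) − (Γξs(2+s)/3)( n⊗(D·n) − (D·n)⊗n ). -/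
open Matrix

/-- `H₀·Q₀ − Q₀·H₀ = Γs²(n⊗N − N⊗n) − (Γξs(2+s)/3)(n⊗(D·n) − (D·n)⊗n)`. -/
theorem stmt_17 (Γ ξ s : ℝ) (n : Fin 3 → ℝ) (hn : n ⬝ᵥ n = 1)
    (N : Fin 3 → ℝ) (hN : N ⬝ᵥ n = 0)
    (D : Matrix (Fin 3) (Fin 3) ℝ) (hDsymm : D.IsSymm) (hDtr : D.trace = 0)
    (Q₀ H₀ : Matrix (Fin 3) (Fin 3) ℝ)
    (hQ₀ : Q₀ = s • (vecMulVec n n - (1 / 3 : ℝ) • (1 : Matrix (Fin 3) (Fin 3) ℝ)))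
    (hH₀ : H₀ = (-(Γ * s)) • (vecMulVec N n + vecMulVec n N) + Γ • Sop ξ Q₀ D) :
    H₀ * Q₀ - Q₀ * H₀ =
      (Γ * s ^ 2) • (vecMulVec n N - vecMulVec N n)
        - (Γ * ξ * s * (2 + s) / 3) • (vecMulVec n (D *ᵥ n) - vecMulVec (D *ᵥ n) n) := by
  have hN' : n ⬝ᵥ N = 0 := by rw [dotProduct_comm, hN]
  have hPP : vecMulVec n n * vecMulVec n n = vecMulVec n n := by
    simp [vecMulVec_mul_vecMulVec, hn]
  have hXP : vecMulVec N n * vecMulVec n n = vecMulVec N n := by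
    simp [vecMulVec_mul_vecMulVec, hn]
  have hYP : vecMulVec n N * vecMulVec n n = 0 := by
    simp [vecMulVec_mul_vecMulVec, hN]
  have hPX : vecMulVec n n * vecMulVec N n = 0 := by
    simp [vecMulVec_mul_vecMulVec, hN']
  have hPY : vecMulVec n n * vecMulVec n N = vecMulVec n N := by
    simp [vecMulVec_mul_vecMulVec, hn]
  have hDP : vecMulVec (D *ᵥ n) n = D * vecMulVec n n := (mul_vecMulVec D n n).symm
  have hPD : vecMulVec n (D *ᵥ n) = vecMulVec n n * D := by
    rw [vecMulVec_mul, ← mulVec_transpose, hDsymm.eq]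
  rw [hDP, hPD, hH₀, Sop]
  generalize frob Q₀ D = t
  rw [hQ₀]
  generalize vecMulVec n n = P at *
  generalize vecMulVec N n = X at *
  generalize vecMulVec n N = Y at *
  have hPPD : P * (P * D) = P * D := by rw [← mul_assoc, hPP]
  simp only [mul_add, add_mul, mul_sub, sub_mul, smul_mul_assoc, mul_smul_comm, mul_one,
    one_mul, smul_add, smul_sub, mul_assoc, hPP, hXP, hYP, hPX, hPY, hPPD]
  module
end

section
/- Let L1, L2, L3, s ∈ ℝ and let n : ℝ³ → ℝ³ be a smooth map with |n(x)| = 1 for all x. Set Q₀(x) = s(n(x)⊗n(x) − (1/3)I) and define k₁ = k₃ = (2L1+L2+L3)s², k₂ = 2L1 s², k₄ = L3 s². Then for all indices i, j ∈ {1,2,3} and all x ∈ ℝ³ (with summation over repeated indices k, l): L1 ∂_j(Q₀)_{kl} ∂_i(Q₀)_{kl} + L2 ∂_l(Q₀)_{kl} ∂_i(Q₀)_{kj} + L3 ∂_l(Q₀)_{kj} ∂_i(Q₀)_{kl} = [ k₁ δ_{kj} ∂_l n_l + k₂( ∂_j n_k − ∂_k n_j − n_l n_j ∂_l n_k ) +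 k₃ n_l n_j ∂_l n_k + (k₂+k₄)( ∂_k n_j − δ_{kj} ∂_l n_l ) ] ∂_i n_k. In other words, the Landau-de Gennes distortion stress evaluated at Q₀ coincides with the Ericksen stress −(∂E_F/∂n_{k,j}) n_{k,i} of the Oseen-Frank energy with constants k₁, k₂, k₃, k₄. -/
open Matrix

theorem pd_mul (i : Fin 3) {f g : (Fin 3 → ℝ) → ℝ} {x : Fin 3 → ℝ}
    (hf : DifferentiableAt ℝ f x) (hg : DifferentiableAt ℝ g x) :
    pd i (fun y => f y * g y) x = pd i f x * g x + f x * pd i g x := by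
  simp only [pd, fderiv_fun_mul hf hg, _root_.add_apply,
    _root_.smul_apply, smul_eq_mul]
  ring

/-- The derivative of a field of constant length is orthogonal to the field. -/
theorem sum_mul_pd_eq_zero {n : (Fin 3 → ℝ) → Fin 3 → ℝ} {x : Fin 3 → ℝ}
    (hn : ∀ k, DifferentiableAt ℝ (fun y => n y k) x)
    (hunit : ∀ x, n x ⬝ᵥ n x = 1) (a : Fin 3) :
    ∑ k, n x k * pd a (fun y => n y k) x = 0 := by
  have hconst : pd a (fun y => ∑ k, n y k * n y k) x = 0 := by
    have h1 : (fun y => ∑ k, n y k * n y k) = fun _ => (1 : ℝ) := funext hunit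
    simp [h1, pd]
  have hsum : pd a (fun y => ∑ k, n y k * n y k) x =
      ∑ k, pd a (fun y => n y k * n y k) x := by
    simp only [pd]
    rw [fderiv_fun_sum fun k _ => (hn k).fun_mul (hn k)]
    simp
  rw [hsum] at hconst
  simp only [pd_mul a (hn _) (hn _), Fin.sum_univ_three] at hconst ⊢
  linarith

/-- The algebraic identity between the two stresses, with `D a b` standing for `∂_a n_b`. -/
theorem distortion_stress_identity (L1 L2 L3 s : ℝ) (m : Fin 3 → ℝ) (D : Fin 3 → Fin 3 → ℝ)
    (hm : ∑ k, m k * m k = 1) (hD : ∀ a, ∑ k, m k * D a k = 0) (i j : Fin 3) :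
    (∑ k, ∑ l,
        (L1 * (s * (D j k * m l + m k * D j l)) * (s * (D i k * m l + m k * D i l))
          + L2 * (s * (D l k * m l + m k * D l l)) * (s * (D i k * m j + m k * D i j))
          + L3 * (s * (D l k * m j + m k * D l j)) * (s * (D i k * m l + m k * D i l))))
      = ∑ k,
          ((2 * L1 + L2 + L3) * s ^ 2 * (if k = j then (1 : ℝ) else 0) * (∑ l, D l l)
            + 2 * L1 * s ^ 2 * (D j k - D k j - ∑ l, m l * m j * D l k)
            + (2 * L1 + L2 + L3) * s ^ 2 * (∑ l, m l * m j * D l k)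
            + (2 * L1 * s ^ 2 + L3 * s ^ 2)
              * (D k j - (if k = j then (1 : ℝ) else 0) * (∑ l, D l l)))
          * D i k := by
  have hdelta : ∑ k, (if k = j then (1 : ℝ) else 0) * D i k = D i j := by simp
  simp only [Fin.sum_univ_three] at hm hD hdelta ⊢
  linear_combination
    s ^ 2 * (L1 * (2 * (D j 0 * D i 0 + D j 1 * D i 1 + D j 2 * D i 2))
      + L2 * (D 0 0 + D 1 1 + D 2 2) * D i j
      + L3 * (D 0 j * D i 0 + D 1 j * D i 1 + D 2 j * D i 2)) * hm
    + s ^ 2 * (L1 * 2 * (m 0 * D j 0 + m 1 * D j 1 + m 2 * D j 2)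
      + L2 * (D 0 0 + D 1 1 + D 2 2) * m j
      + L3 * (m 0 * D 0 j + m 1 * D 1 j + m 2 * D 2 j)) * hD i
    + s ^ 2 * (L2 * D i j * m 0 + L3 * m j * D i 0) * hD 0
    + s ^ 2 * (L2 * D i j * m 1 + L3 * m j * D i 1) * hD 1
    + s ^ 2 * (L2 * D i j * m 2 + L3 * m j * D i 2) * hD 2
    - s ^ 2 * L2 * (D 0 0 + D 1 1 + D 2 2) * hdelta

/-- The Landau-de Gennes distortion stress evaluated at `Q₀ = s(n⊗n − (1/3)I)`
coincides with the Ericksen stress `−(∂E_F/∂n_{k,j}) n_{k,i}` of the Oseen-Frank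
energy with constants `k₁ = k₃ = (2L1+L2+L3)s²`, `k₂ = 2L1 s²`, `k₄ = L3 s²`. -/
theorem stmt_18 (L1 L2 L3 s : ℝ) (n : (Fin 3 → ℝ) → Fin 3 → ℝ)
    (hsmooth : ∀ k, ContDiff ℝ (⊤ : ℕ∞) (fun y => n y k))
    (hunit : ∀ x, (n x) ⬝ᵥ (n x) = 1)
    (Q₀ : (Fin 3 → ℝ) → Matrix (Fin 3) (Fin 3) ℝ)
    (hQ₀ : ∀ x, Q₀ x =
      s • (vecMulVec (n x) (n x) - (1 / 3 : ℝ) • (1 : Matrix (Fin 3) (Fin 3) ℝ)))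
    (k₁ k₂ k₃ k₄ : ℝ)
    (hk₁ : k₁ = (2 * L1 + L2 + L3) * s ^ 2) (hk₂ : k₂ = 2 * L1 * s ^ 2)
    (hk₃ : k₃ = (2 * L1 + L2 + L3) * s ^ 2) (hk₄ : k₄ = L3 * s ^ 2)
    (i j : Fin 3) (x : Fin 3 → ℝ) :
    (∑ k, ∑ l,
        (L1 * pd j (fun y => Q₀ y k l) x * pd i (fun y => Q₀ y k l) x
          + L2 * pd l (fun y => Q₀ y k l) x * pd i (fun y => Q₀ y k j) x
          + L3 * pd l (fun y => Q₀ y k j) x * pd i (fun y => Q₀ y k l) x))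
      = ∑ k,
          (k₁ * (if k = j then (1 : ℝ) else 0) * (∑ l, pd l (fun y => n y l) x)
            + k₂ * (pd j (fun y => n y k) x - pd k (fun y => n y j) x
                - ∑ l, n x l * n x j * pd l (fun y => n y k) x)
            + k₃ * (∑ l, n x l * n x j * pd l (fun y => n y k) x)
            + (k₂ + k₄) * (pd k (fun y => n y j) x
                - (if k = j then (1 : ℝ) else 0) * (∑ l, pd l (fun y => n y l) x)))
          * pd i (fun y => n y k) x := by
  have hn : ∀ k, DifferentiableAt ℝ (fun y => n y k) x := fun k =>
    (hsmooth k).contDiffAt.differentiableAt (by simp)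
  have hpdQ : ∀ a k l, pd a (fun y => Q₀ y k l) x =
      s * (pd a (fun y => n y k) x * n x l + n x k * pd a (fun y => n y l) x) := by
    intro a k l
    have hQ : (fun y => Q₀ y k l) = fun y =>
        s * (n y k * n y l - (1 / 3 : ℝ) * (1 : Matrix (Fin 3) (Fin 3) ℝ) k l) := by
      funext y
      simp [hQ₀ y, vecMulVec_apply]
    rw [hQ, ← pd_mul a (hn k) (hn l)]
    simp only [pd]
    rw [fderiv_const_mul (((hn k).fun_mul (hn l)).sub_const _), fderiv_sub_const]
    rfl
  subst hk₁ hk₂ hk₃ hk₄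
  simp only [hpdQ]
  exact distortion_stress_identity L1 L2 L3 s (n x) (fun a b => pd a (fun y => n y b) x)
    (hunit x) (sum_mul_pd_eq_zero hn hunit) i j
end
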